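/- Let L be a type and let U be an ultrafilter on Set L (i.e., on the powerset of L, viewing members of U as collections of subsets of L) which is fine, meaning that for every a ∈ L the collection {x ⊆ L : a ∈ x} belongs to U, and normal, meaning that for every family ⟨A_a : a ∈ L⟩ of members of U, the diagonal intersection {x ⊆ L : for all a ∈ x, x ∈ A_a} belongs to U. Then for every permutation h : L ≃ L and every collection A of subsets of L, the symmetric difference A △ h_{**}(A), where h_{**}(A) = {h '' x : x ∈ A}, has measure zero with respect to U; that is, its complement belongs to U. -/

import Mathlib

/-- Almost every set, for a fine normal ultrafilter, is closed under a given function. -/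
theorem mapsTo_mem_of_normal_fine {L : Type*} (U : Ultrafilter (Set L))
    (fine : ∀ a : L, {x : Set L | a ∈ x} ∈ U)
    (normal : ∀ A : L → Set (Set L), (∀ a : L, A a ∈ U) →
      {x : Set L | ∀ a ∈ x, x ∈ A a} ∈ U)
    (f : L → L) : {x : Set L | Set.MapsTo f x x} ∈ U :=
  normal (fun a => {x | f a ∈ x}) fun a => fine (f a)

/-- Almost every set, for a fine normal ultrafilter, is fixed by a given permutation. -/
theorem image_eq_self_mem_of_normal_fine {L : Type*} (U : Ultrafilter (Set L))
    (fine : ∀ a : L, {x : Set L | a ∈ x} ∈ U)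
    (normal : ∀ A : L → Set (Set L), (∀ a : L, A a ∈ U) →
      {x : Set L | ∀ a ∈ x, x ∈ A a} ∈ U)
    (h : L ≃ L) : {x : Set L | (h : L → L) '' x = x} ∈ U := by
  filter_upwards [mapsTo_mem_of_normal_fine U fine normal h,
    mapsTo_mem_of_normal_fine U fine normal h.symm] with x hx hx'
  exact hx.image_subset.antisymm fun a ha => ⟨h.symm a, hx' ha, h.apply_symm_apply a⟩

/-- If `U` is a fine normal ultrafilter on the powerset of `L`,
then for every permutation `h` of `L` and every collection `A` of subsets of
`L`, the symmetric difference `A ∆ h_{**}(A)` (where `h_{**}(A) = {h '' x : x ∈ A}`)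
has measure zero with respect to `U`, i.e. its complement belongs to `U`. -/
theorem symmDiff_null_of_normal_fine {L : Type*} (U : Ultrafilter (Set L))
    (fine : ∀ a : L, {x : Set L | a ∈ x} ∈ U)
    (normal : ∀ A : L → Set (Set L), (∀ a : L, A a ∈ U) →
      {x : Set L | ∀ a ∈ x, x ∈ A a} ∈ U)
    (h : L ≃ L) (A : Set (Set L)) :
    (symmDiff A ((fun x : Set L => (h : L → L) '' x) '' A))ᶜ ∈ U := by
  filter_upwards [image_eq_self_mem_of_normal_fine U fine normal h] with x hx
  have mem_iff : x ∈ (fun x : Set L => (h : L → L) '' x) '' A ↔ x ∈ A := by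
    constructor
    · rintro ⟨y, hy, hyx⟩
      rwa [← h.injective.image_injective (hyx.trans hx.symm)]
    · exact fun hxA => ⟨x, hxA, hx⟩
  rw [Set.mem_compl_iff, Set.mem_symmDiff, mem_iff]
  tauto
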